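/- Let G be a supersolvable group, H a subgroup of G, and χ : H →* ℂˣ a character such that for every g ∈ G with g ∉ H there exists x ∈ H^g ∩ H with χ^g(x) ≠ χ(x). Then the induced representation Ind_H^G(χ) is a simple ℂ[G]-module. -/

import Mathlib

open scoped TensorProduct

/-- A group is supersolvable if it has a finite chain of subgroups, each normal in `G`,
going from `⊤` down to `⊥`, with each successive quotient cyclic (equivalently, each
step is generated over the next one by a single element). -/
def IsSupersolvable (G : Type*) [Group G] : Prop :=
  ∃ (k : ℕ) (N : ℕ → Subgroup G),
    N 0 = ⊤ ∧ N (k + 1) = ⊥ ∧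
    (∀ i, N (i + 1) ≤ N i) ∧
    (∀ i, (N i).Normal) ∧
    (∀ i ≤ k, ∃ g : G, N i = N (i + 1) ⊔ Subgroup.closure {g})

/-- `Ind_H^G χ = ℂ[G] ⊗_{ℂ[H]} ℂ_χ`, realized as the quotient of `ℂ[G]` by the left
`ℂ[G]`-submodule generated by the elements `h - χ(h)·1` for `h ∈ H`. -/
noncomputable abbrev IndChar {G : Type*} [Group G] (H : Subgroup G) (χ : H →* ℂˣ) :=
  MonoidAlgebra ℂ G ⧸ Submodule.span (MonoidAlgebra ℂ G)
    {x : MonoidAlgebra ℂ G | ∃ h : H,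
      x = MonoidAlgebra.single (h : G) (1 : ℂ) - (χ h : ℂ) • (1 : MonoidAlgebra ℂ G)}

section Lattice

/-- In a modular lattice, if finitely many elements covered by `V` meet trivially inside a nonzero
`Y ≤ V`, then there is an atom below `Y`. -/
theorem exists_isAtom_le_of_inf_covBy_eq_bot {α ι : Type*} [Lattice α] [IsModularLattice α]
    [BoundedOrder α] {V : α} (u : ι → α) (s : Finset ι) (hu : ∀ i ∈ s, u i ⋖ V) :
    ∀ Y ≤ V, Y ≠ ⊥ → Y ⊓ s.inf u = ⊥ → ∃ X ≤ Y, IsAtom X := by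
  classical
  induction s using Finset.induction_on with
  | empty => intro Y _ hY h; exact absurd (by simpa using h) hY
  | insert i s _ ih =>
    intro Y hYV hY h
    have hui := hu i (Finset.mem_insert_self i s)
    rw [Finset.inf_insert, ← inf_assoc] at h
    by_cases hYi : Y ⊓ u i = ⊥
    · refine ⟨Y, le_rfl, ?_⟩
      have hsup : Y ⊔ u i = V := by
        refine (hui.eq_or_eq le_sup_right (sup_le hYV hui.le)).resolve_left fun h' => hY ?_
        rw [← hYi, inf_eq_left.2 (h' ▸ le_sup_left)]
      have : Y ⊓ u i ⋖ Y := by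
        apply inf_covBy_of_covBy_sup_right
        rwa [hsup]
      rwa [hYi, bot_covBy_iff] at this
    · obtain ⟨X, hX, hX'⟩ := ih (fun j hj => hu j (Finset.mem_insert_of_mem hj)) (Y ⊓ u i)
        (inf_le_left.trans hYV) hYi h
      exact ⟨X, hX.trans inf_le_left, hX'⟩

end Lattice

section Clifford

variable {k G M : Type*} [Field k] [Group G] [AddCommGroup M] [Module k M]

/-- The `k`-span of the `Q`-orbit of `e`. -/
def orbitSpan (ρ : Representation k G M) (Q : Subgroup G) (e : M) : Submodule k M :=
  Submodule.span k (Set.range fun q : Q => ρ q e)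

/-- The subspace `W` is stable under the subgroup `Q`. -/
def IsStableUnder (ρ : Representation k G M) (Q : Subgroup G) (W : Submodule k M) : Prop :=
  ∀ q ∈ Q, ∀ w ∈ W, ρ q w ∈ W

/-- The span of the `Q`-orbit of `e` has no proper nonzero `Q`-stable subspace. -/
def IsSimpleOrbit (ρ : Representation k G M) (Q : Subgroup G) (e : M) : Prop :=
  ∀ W ≤ orbitSpan ρ Q e, IsStableUnder ρ Q W → W ≠ ⊥ → e ∈ W

variable {ρ : Representation k G M} {Q P L : Subgroup G} {e : M}

theorem apply_mem_orbitSpan {q : G} (hq : q ∈ Q) : ρ q e ∈ orbitSpan ρ Q e :=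
  Submodule.subset_span ⟨⟨q, hq⟩, rfl⟩

theorem mem_orbitSpan_self : e ∈ orbitSpan ρ Q e := by
  simpa using apply_mem_orbitSpan (ρ := ρ) (e := e) Q.one_mem

theorem orbitSpan_le {W : Submodule k M} (hW : IsStableUnder ρ Q W) (he : e ∈ W) :
    orbitSpan ρ Q e ≤ W :=
  Submodule.span_le.2 (by rintro _ ⟨q, rfl⟩; exact hW q q.2 e he)

theorem isStableUnder_orbitSpan : IsStableUnder ρ Q (orbitSpan ρ Q e) := by
  intro q hq w hw
  induction hw using Submodule.span_induction with
  | mem x hx =>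
    obtain ⟨q', rfl⟩ := hx
    rw [← Module.End.mul_apply, ← map_mul]
    exact apply_mem_orbitSpan (Q.mul_mem hq q'.2)
  | zero => simp
  | add x y _ _ hx hy => rw [map_add]; exact add_mem hx hy
  | smul a x _ hx => rw [map_smul]; exact Submodule.smul_mem _ _ hx

theorem IsStableUnder.mono {W : Submodule k M} (h : IsStableUnder ρ P W) (hQ : Q ≤ P) :
    IsStableUnder ρ Q W := fun q hq => h q (hQ hq)

variable (ρ L) in
/-- The submodules of `M` as a module over the group algebra of `L`. -/
abbrev ResSubmodule : Type _ :=
  Submodule (MonoidAlgebra k L) (Representation.asModule (ρ.comp L.subtype))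

/-- An `L`-stable subspace as a submodule over the group algebra of `L`. -/
def IsStableUnder.toRes {U : Submodule k M} (hU : IsStableUnder ρ L U) : ResSubmodule ρ L :=
  Subrepresentation.asSubmodule (ρ := ρ.comp L.subtype) ⟨U, fun g v hv => hU g g.2 v hv⟩

/-- The subspace underlying a submodule over the group algebra of `L`. -/
def ResSubmodule.toSubspace (N : ResSubmodule ρ L) : Submodule k M :=
  (Subrepresentation.ofSubmodule' N).toSubmodule

theorem ResSubmodule.isStableUnder (N : ResSubmodule ρ L) : IsStableUnder ρ L N.toSubspace :=
  fun q hq _ hw => (Subrepresentation.ofSubmodule' N).apply_mem_toSubmodule ⟨q, hq⟩ hw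

theorem ResSubmodule.mem_toSubspace {N : ResSubmodule ρ L} {v : M} :
    v ∈ N.toSubspace ↔ (show Representation.asModule (ρ.comp L.subtype) from v) ∈ N := Iff.rfl

theorem ResSubmodule.toSubspace_le {N N' : ResSubmodule ρ L} :
    N.toSubspace ≤ N'.toSubspace ↔ N ≤ N' := Iff.rfl

theorem ResSubmodule.toSubspace_inj {N N' : ResSubmodule ρ L} :
    N.toSubspace = N'.toSubspace ↔ N = N' := by
  simp only [le_antisymm_iff, toSubspace_le]

theorem ResSubmodule.toSubspace_eq_bot {N : ResSubmodule ρ L} :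
    N.toSubspace = ⊥ ↔ N = ⊥ := by
  rw [← toSubspace_inj]; rfl

/-- Translation of `L`-stable subspaces by an element normalizing `L`. -/
def translateRes (p : Subgroup.normalizer (L : Set G)) : ResSubmodule ρ L ≃o ResSubmodule ρ L :=
  have aux (p : Subgroup.normalizer (L : Set G)) (N : ResSubmodule ρ L) :
      IsStableUnder ρ L (N.toSubspace.comap (ρ ((p : G)⁻¹))) := by
    intro l hl w hw
    have := N.isStableUnder _ ((Subgroup.mem_normalizer_iff''.1 p.2 l).1 hl) _ hw
    rw [Submodule.mem_comap]
    rw [← Module.End.mul_apply, ← map_mul] at this ⊢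
    simpa [mul_assoc] using this
  { toFun N := (aux p N).toRes
    invFun N := (aux p⁻¹ N).toRes
    left_inv N := by
      refine ResSubmodule.toSubspace_inj.1 (Submodule.ext fun v => ?_)
      change ρ _ (ρ _ v) ∈ N.toSubspace ↔ v ∈ N.toSubspace
      rw [← Module.End.mul_apply, ← map_mul]
      simp
    right_inv N := by
      refine ResSubmodule.toSubspace_inj.1 (Submodule.ext fun v => ?_)
      change ρ _ (ρ _ v) ∈ N.toSubspace ↔ v ∈ N.toSubspace
      rw [← Module.End.mul_apply, ← map_mul]
      simp
    map_rel_iff' {N N'} := by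
      constructor
      · refine fun h => ResSubmodule.toSubspace_le.1 fun v hv => ?_
        have := @h (ρ (p : G) v)
        change ρ _ (ρ _ v) ∈ N.toSubspace → ρ _ (ρ _ v) ∈ N'.toSubspace at this
        rw [← Module.End.mul_apply, ← map_mul] at this
        exact (by simpa using this : v ∈ N.toSubspace → v ∈ N'.toSubspace) hv
      · intro h v hv
        exact h hv }

theorem mem_translateRes {p : Subgroup.normalizer (L : Set G)} {N : ResSubmodule ρ L} {v : M} :
    v ∈ (translateRes p N).toSubspace ↔ ρ ((p : G)⁻¹) v ∈ N.toSubspace := Iff.rfl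

theorem translateRes_mul (p q : Subgroup.normalizer (L : Set G)) (N : ResSubmodule ρ L) :
    translateRes (p * q) N = translateRes p (translateRes q N) := by
  refine ResSubmodule.toSubspace_inj.1 (Submodule.ext fun v => ?_)
  simp [mem_translateRes]

theorem translateRes_eq_self {p : Subgroup.normalizer (L : Set G)} {N : ResSubmodule ρ L}
    (hN : IsStableUnder ρ Q N.toSubspace) (hp : (p : G) ∈ Q) : translateRes p N = N := by
  refine ResSubmodule.toSubspace_inj.1 (Submodule.ext fun v => ?_)
  rw [mem_translateRes]
  refine ⟨fun h => ?_, fun h => hN _ (Q.inv_mem hp) _ h⟩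
  simpa using hN _ hp _ h

theorem isStableUnder_of_le_translateRes {N : ResSubmodule ρ L}
    (hP : P ≤ Subgroup.normalizer (L : Set G))
    (h : ∀ p (hp : p ∈ P), N ≤ translateRes ⟨p, hP hp⟩ N) : IsStableUnder ρ P N.toSubspace := by
  intro p hp w hw
  have := ResSubmodule.toSubspace_le.2 (h p⁻¹ (P.inv_mem hp)) hw
  rw [mem_translateRes] at this
  simpa using this

theorem fg_toRes_orbitSpan (hLQ : L ≤ Q) [(L.subgroupOf Q).FiniteIndex] :
    ((isStableUnder_orbitSpan (ρ := ρ) (e := e)).mono hLQ).toRes.FG := by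
  set V := ((isStableUnder_orbitSpan (ρ := ρ) (e := e)).mono hLQ).toRes
  let f : Q ⧸ L.subgroupOf Q → Representation.asModule (ρ.comp L.subtype) :=
    fun t => ρ ((t.out : Q) : G)⁻¹ e
  have hle : V ≤ Submodule.span (MonoidAlgebra k L) (Set.range f) := by
    rw [← ResSubmodule.toSubspace_le]
    refine Submodule.span_le.2 ?_
    rintro _ ⟨q, rfl⟩
    obtain ⟨l, hl⟩ := QuotientGroup.mk_out_eq_mul (L.subgroupOf Q) q⁻¹
    have hq : (q : G) =
        (l : Q) * (((QuotientGroup.mk q⁻¹ : Q ⧸ L.subgroupOf Q).out : Q) : G)⁻¹ := by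
      rw [hl]; simp
    have hmem : ρ ((((QuotientGroup.mk q⁻¹ : Q ⧸ L.subgroupOf Q).out : Q) : G)⁻¹) e ∈
        ResSubmodule.toSubspace (Submodule.span (MonoidAlgebra k L) (Set.range f)) :=
      Submodule.subset_span (R := MonoidAlgebra k L)
        (M := Representation.asModule (ρ.comp L.subtype)) ⟨_, rfl⟩
    have := ResSubmodule.isStableUnder _ _ (Subgroup.mem_subgroupOf.1 l.2) _ hmem
    rw [← Module.End.mul_apply, ← map_mul, ← hq] at this
    exact this
  have hge : Submodule.span (MonoidAlgebra k L) (Set.range f) ≤ V := by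
    refine Submodule.span_le.2 ?_
    rintro _ ⟨t, rfl⟩
    exact apply_mem_orbitSpan (Q.inv_mem t.out.2)
  rw [le_antisymm hle hge]
  exact Submodule.fg_span (Set.finite_range f)

/-- A weak form of Clifford's theorem: the restriction of a simple representation to a normal
subgroup of finite index contains a simple subrepresentation. -/
theorem IsSimpleOrbit.exists_isAtom (hs : IsSimpleOrbit ρ Q e) (he : e ≠ 0) (hLQ : L ≤ Q)
    (hQ : Q ≤ Subgroup.normalizer (L : Set G)) [(L.subgroupOf Q).FiniteIndex] :
    ∃ X : ResSubmodule ρ L, IsAtom X ∧ X.toSubspace ≤ orbitSpan ρ Q e := by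
  classical
  have hst := isStableUnder_orbitSpan (ρ := ρ) (e := e) (Q := Q)
  set V := (hst.mono hLQ).toRes
  have hVs : V.toSubspace = orbitSpan ρ Q e := rfl
  have hVbot : V ≠ ⊥ := by
    rw [Ne, ← ResSubmodule.toSubspace_eq_bot, hVs, Submodule.eq_bot_iff]
    exact fun h => he (h e mem_orbitSpan_self)
  obtain ⟨U, hU⟩ : ∃ U, U ⋖ V := by
    have := CompleteLattice.Iic_coatomic_of_compact_element
      ((Submodule.fg_iff_compact _).1 (fg_toRes_orbitSpan (ρ := ρ) (e := e) hLQ))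
    obtain h | ⟨U, hU, -⟩ := this.eq_top_or_exists_le_coatom ⊥
    · exact absurd (congrArg Subtype.val h).symm hVbot
    · exact ⟨U.1, (covBy_iff_coatom_Iic U.2).2 hU⟩
  let n (q : Q) : Subgroup.normalizer (L : Set G) := ⟨q, hQ q.2⟩
  have hn (q : Q) : translateRes (n q) V = V := translateRes_eq_self (hVs ▸ hst) q.2
  let u (t : Q ⧸ L.subgroupOf Q) : ResSubmodule ρ L := translateRes (n t.out) U
  have hu (q : Q) : translateRes (n q) U = u q := by
    obtain ⟨l, hl⟩ := QuotientGroup.mk_out_eq_mul (L.subgroupOf Q) q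
    have hnl : n (q * l) = n q * n l := rfl
    simp only [u]
    rw [hl, hnl, translateRes_mul, translateRes_eq_self (Q := L) (p := n l) U.isStableUnder
      (Subgroup.mem_subgroupOf.1 l.2)]
  let _ := Fintype.ofFinite (Q ⧸ L.subgroupOf Q)
  have hcov (t) : u t ⋖ V := by
    rw [← hn t.out]
    exact (apply_covBy_apply_iff _).2 hU
  have hmem {v : M} : v ∈ (V ⊓ Finset.univ.inf u).toSubspace ↔
      v ∈ orbitSpan ρ Q e ∧ ∀ q : Q, ρ ((q : G)⁻¹) v ∈ U.toSubspace := by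
    have h1 : v ∈ (V ⊓ Finset.univ.inf u).toSubspace ↔
      v ∈ orbitSpan ρ Q e ∧ v ∈ (Finset.univ.inf u).toSubspace := Iff.rfl
    rw [h1, ResSubmodule.mem_toSubspace, Submodule.mem_finsetInf]
    refine and_congr_right fun _ => ⟨fun h q => ?_, fun h t _ => h t.out⟩
    have := h q (Finset.mem_univ _)
    rw [← hu] at this
    exact this
  have hcore : V ⊓ Finset.univ.inf u = ⊥ := by
    by_contra hne
    have heD := hs (V ⊓ Finset.univ.inf u).toSubspace (fun v hv => (hmem.1 hv).1)
      (fun q hq v hv => by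
        have hv := hmem.1 hv
        refine hmem.2 ⟨hst q hq v hv.1, fun q' => ?_⟩
        have := hv.2 (⟨q, hq⟩⁻¹ * q')
        rw [← Module.End.mul_apply, ← map_mul]
        simpa using this) (by rwa [Ne, ResSubmodule.toSubspace_eq_bot])
    refine hU.lt.not_ge (ResSubmodule.toSubspace_le.1 ?_)
    refine Submodule.span_le.2 ?_
    rintro _ ⟨q, rfl⟩
    simpa using (hmem.1 heD).2 q⁻¹
  obtain ⟨X, hXV, hX⟩ := exists_isAtom_le_of_inf_covBy_eq_bot u Finset.univ (fun t _ => hcov t)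
    V le_rfl hVbot hcore
  exact ⟨X, hX, ResSubmodule.toSubspace_le.2 hXV⟩

/-- If `L` is a finite-index normal subgroup of `Q` which is normalized by `P`, and the `Q`-span
of `e` is simple, then the `P`-span of `e` is semisimple as a representation of `L`. -/
theorem IsSimpleOrbit.exists_complement (hs : IsSimpleOrbit ρ Q e) (he : e ≠ 0) (hLQ : L ≤ Q)
    (hQP : Q ≤ P) (hP : P ≤ Subgroup.normalizer (L : Set G)) [(L.subgroupOf Q).FiniteIndex]
    {W K : Submodule k M} (hW : IsStableUnder ρ L W) (hK : IsStableUnder ρ L K)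
    (hWP : W ≤ orbitSpan ρ P e) :
    ∃ X ≤ W, IsStableUnder ρ L X ∧ X ⊓ K = ⊥ ∧ W ≤ X ⊔ K := by
  obtain ⟨S, hS, hSQ⟩ := hs.exists_isAtom he hLQ (hQP.trans hP)
  set A : ResSubmodule ρ L := sSup {X | IsAtom X} with hA
  have hAst : IsStableUnder ρ P A.toSubspace := by
    refine isStableUnder_of_le_translateRes hP fun p hp => ?_
    refine sSup_le fun X hX => ?_
    rw [← OrderIso.symm_apply_le]
    exact le_sSup ((OrderIso.isAtom_iff _ _).2 hX)
  have heA : e ∈ A.toSubspace := by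
    have := hs (orbitSpan ρ Q e ⊓ A.toSubspace) inf_le_left
      (fun q hq v hv => ⟨isStableUnder_orbitSpan q hq v hv.1, hAst q (hQP hq) v hv.2⟩) ?_
    · exact this.2
    · intro h
      refine hS.1 (ResSubmodule.toSubspace_eq_bot.1 (le_bot_iff.1 ?_))
      rw [← h]
      exact le_inf hSQ (ResSubmodule.toSubspace_le.2 (le_sSup hS))
  have hWA : hW.toRes ≤ A := ResSubmodule.toSubspace_le.1 (hWP.trans (orbitSpan_le hAst heA))
  have hAss : IsSemisimpleModule (MonoidAlgebra k L) A := by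
    rw [hA, sSup_eq_iSup]
    refine isSemisimpleModule_biSup_of_isSemisimpleModule_submodule fun X hX => ?_
    have : IsSimpleModule (MonoidAlgebra k L) X := isSimpleModule_iff_isAtom.2 hX
    infer_instance
  have hWss : IsSemisimpleModule (MonoidAlgebra k L) hW.toRes :=
    .of_injective (Submodule.inclusion hWA) (Submodule.inclusion_injective hWA)
  obtain ⟨X, hX'⟩ := exists_isCompl (hK.toRes.comap hW.toRes.subtype)
  have hX := hX'.symm
  let Y : ResSubmodule ρ L := X.map hW.toRes.subtype
  refine ⟨Y.toSubspace, ?_, ResSubmodule.isStableUnder _, ?_, ?_⟩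
  · exact ResSubmodule.toSubspace_le.2 (Submodule.map_subtype_le _ _ : Y ≤ hW.toRes)
  · rw [Submodule.eq_bot_iff]
    rintro _ ⟨⟨x, hx, rfl⟩, hxK⟩
    have : x ∈ X ⊓ hK.toRes.comap hW.toRes.subtype := ⟨hx, hxK⟩
    rw [hX.inf_eq_bot, Submodule.mem_bot] at this
    rw [this]; rfl
  · intro w hw
    have : (⟨w, hw⟩ : hW.toRes) ∈ X ⊔ hK.toRes.comap hW.toRes.subtype :=
      hX.sup_eq_top ▸ Submodule.mem_top
    obtain ⟨x, hx, y, hy, hxy⟩ := Submodule.mem_sup.1 this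
    exact Submodule.mem_sup.2 ⟨x.1, ⟨x, hx, rfl⟩, y.1, hy, congrArg Subtype.val hxy⟩

variable {H C : Subgroup G} {χ : H →* kˣ}

/-- An eigenvector for the finite-index subgroup `H ⊓ C` of `H` can be averaged to an eigenvector
for `H`. -/
theorem exists_eigenvector_of_finiteIndex [CharZero k] [C.FiniteIndex] {X : Submodule k M}
    (hX : IsStableUnder ρ H X) {x : M} (hxX : x ∈ X)
    (hx : ∀ h : H, (h : G) ∈ C → ρ h x = (χ h : k) • x) (p : M →ₗ[k] M)
    (hpH : ∀ (h : H) v, p (ρ h v) = ρ h (p v)) (hp : ∀ h : H, ρ h (p x) = (χ h : k) • p x)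
    (hpx : p x ≠ 0) :
    ∃ w ∈ X, (∀ h : H, ρ h w = (χ h : k) • w) ∧ p w ≠ 0 := by
  let φ (h : H) : M := (((χ h)⁻¹ : kˣ) : k) • ρ h x
  have hφ (h l : H) (hl : (l : G) ∈ C) : φ (h * l) = φ h := by
    simp [φ, hx l hl, smul_smul, mul_comm]
  have hφmul (h l : H) : ρ h (φ l) = (χ h : k) • φ (h * l) := by
    simp [φ, smul_smul, mul_comm]
  let _ := Fintype.ofFinite (H ⧸ C.subgroupOf H)
  let ψ (t : H ⧸ C.subgroupOf H) : M := φ t.out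
  have hψ (h : H) : ψ h = φ h := by
    obtain ⟨l, hl⟩ := QuotientGroup.mk_out_eq_mul (C.subgroupOf H) h
    simp only [ψ]
    rw [hl, hφ _ _ (Subgroup.mem_subgroupOf.1 l.2)]
  refine ⟨∑ t, ψ t, sum_mem fun t _ => X.smul_mem _ (hX _ t.out.2 _ hxX), fun h => ?_, ?_⟩
  · rw [map_sum, Finset.smul_sum]
    refine Fintype.sum_equiv (MulAction.toPerm h) _ _ fun t => ?_
    obtain ⟨l, rfl⟩ := QuotientGroup.mk_surjective t
    have : MulAction.toPerm h (l : H ⧸ C.subgroupOf H) = ((h * l : H) : H ⧸ C.subgroupOf H) := rfl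
    rw [this, hψ, hψ, hφmul]
  · have hpψ (t) : p (ψ t) = p x := by
      simp only [ψ, φ, map_smul]
      rw [hpH, hp, smul_smul]
      simp
    rw [map_sum, Finset.sum_congr rfl fun t _ => hpψ t, Finset.sum_const,
      ← Nat.cast_smul_eq_nsmul k]
    exact smul_ne_zero (Nat.cast_ne_zero.2 Finset.univ_nonempty.card_pos.ne') hpx

/-- Simplicity passes from the span of the `Q`-orbit of `e` to the span of its `P`-orbit, provided
`Q` has a subgroup `Q ⊓ C` of finite index normalized by `P`, and `e` is, up to scalars, the only
eigenvector of `H` with character `χ`. -/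
theorem IsSimpleOrbit.of_normalizer [CharZero k] [C.FiniteIndex] (hs : IsSimpleOrbit ρ Q e)
    (he : e ≠ 0) (hHQ : H ≤ Q) (hQP : Q ≤ P)
    (hP : P ≤ Subgroup.normalizer ((Q ⊓ C : Subgroup G) : Set G))
    (heχ : ∀ h : H, ρ h e = (χ h : k) • e)
    (hmackey : ∀ v, (∀ h : H, ρ h v = (χ h : k) • v) → ∃ c : k, v = c • e)
    (p : M →ₗ[k] M) (hpQ : ∀ q ∈ Q, ∀ v, p (ρ q v) = ρ q (p v))
    (hpmem : ∀ v, p v ∈ orbitSpan ρ Q e)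
    (hp : ∀ w ∈ orbitSpan ρ P e, w ≠ 0 → ∃ g ∈ P, p (ρ g w) ≠ 0) :
    IsSimpleOrbit ρ P e := by
  intro W hWP hW hW0
  have hWQ := hW.mono hQP
  obtain ⟨w₁, hw₁, hpw₁⟩ : ∃ w ∈ W, p w = e := by
    refine hs (W.map p) ?_ ?_ ?_
    · rintro _ ⟨w, -, rfl⟩
      exact hpmem w
    · rintro q hq _ ⟨w, hw, rfl⟩
      exact ⟨ρ q w, hWQ q hq w hw, hpQ q hq w⟩
    · obtain ⟨w, hw, hw0⟩ := Submodule.exists_mem_ne_zero_of_ne_bot hW0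
      obtain ⟨g, hg, hgw⟩ := hp w (hWP hw) hw0
      exact fun h => hgw ((Submodule.eq_bot_iff _).1 h _ ⟨_, hW g hg w hw, rfl⟩)
  have hK : IsStableUnder ρ Q (W ⊓ LinearMap.ker p) := fun q hq v hv =>
    ⟨hWQ q hq v hv.1, by
      rw [SetLike.mem_coe, LinearMap.mem_ker, hpQ q hq, LinearMap.mem_ker.1 hv.2, map_zero]⟩
  have : ((Q ⊓ C).subgroupOf Q).FiniteIndex := by
    rw [Subgroup.inf_subgroupOf_left]
    infer_instance
  obtain ⟨X, hXW, hX, hXK, hWX⟩ := hs.exists_complement he (inf_le_left : Q ⊓ C ≤ Q) hQP hP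
    (hWQ.mono inf_le_left) (hK.mono inf_le_left) hWP
  obtain ⟨x, hx, y, hy, rfl⟩ := Submodule.mem_sup.1 (hWX hw₁)
  rw [map_add, LinearMap.mem_ker.1 hy.2, add_zero] at hpw₁
  have hpH (h : H) (v : M) : p (ρ h v) = ρ h (p v) := hpQ h (hHQ h.2) v
  have hxχ (h : H) (hh : (h : G) ∈ C) : ρ h x = (χ h : k) • x := by
    have hmem : ρ h x - (χ h : k) • x ∈ X :=
      sub_mem (hX h ⟨hHQ h.2, hh⟩ x hx) (X.smul_mem _ hx)
    have : ρ h x - (χ h : k) • x ∈ X ⊓ (W ⊓ LinearMap.ker p) :=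
      ⟨hmem, hXW hmem, by
        rw [SetLike.mem_coe, LinearMap.mem_ker, map_sub, map_smul, hpH, hpw₁, heχ, sub_self]⟩
    rw [hXK, Submodule.mem_bot] at this
    exact sub_eq_zero.1 this
  obtain ⟨w, hw, hwχ, hpw⟩ := exists_eigenvector_of_finiteIndex (hWQ.mono hHQ) (hXW hx) hxχ p hpH
    (by simpa [hpw₁] using heχ) (by rwa [hpw₁])
  obtain ⟨c, rfl⟩ := hmackey w hwχ
  have hc : c ≠ 0 := by rintro rfl; simp at hpw
  simpa [smul_smul, hc] using W.smul_mem c⁻¹ hw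

/-- The span of the `H`-orbit of an `H`-eigenvector is simple. -/
theorem isSimpleOrbit_of_eigenvector (heχ : ∀ h : H, ρ h e = (χ h : k) • e) :
    IsSimpleOrbit ρ H e := by
  intro W hWe _ hW0
  obtain ⟨w, hw, hw0⟩ := Submodule.exists_mem_ne_zero_of_ne_bot hW0
  have hle : orbitSpan ρ H e ≤ Submodule.span k {e} :=
    Submodule.span_le.2 (by
      rintro _ ⟨h, rfl⟩
      exact Submodule.mem_span_singleton.2 ⟨_, (heχ h).symm⟩)
  obtain ⟨c, rfl⟩ := Submodule.mem_span_singleton.1 (hle (hWe hw))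
  have hc : c ≠ 0 := by rintro rfl; simp at hw0
  simpa [smul_smul, hc] using W.smul_mem c⁻¹ hw

end Clifford

section Supersolvable

/-- The centralizer of a normal cyclic section `P / N` contains a normal finite-index subgroup. -/
theorem exists_finiteIndex_commutator_mem {G : Type*} [Group G] {P N : Subgroup G} [P.Normal]
    [N.Normal] {g : G} (h : P = N ⊔ Subgroup.closure {g}) :
    ∃ C : Subgroup G, C.Normal ∧ C.FiniteIndex ∧ ∀ x ∈ C, g * x * g⁻¹ * x⁻¹ ∈ N := by
  let π := QuotientGroup.mk' N
  have hZ : P.map π = Subgroup.zpowers (π g) := by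
    rw [h, Subgroup.map_sup, MonoidHom.map_closure, Set.image_singleton,
      ← Subgroup.zpowers_eq_closure, sup_eq_right]
    rintro _ ⟨n, hn, rfl⟩
    rw [show π n = 1 from (QuotientGroup.eq_one_iff (N := N) n).2 hn]
    exact one_mem _
  have : (Subgroup.zpowers (π g)).Normal :=
    hZ ▸ Subgroup.Normal.map inferInstance π (QuotientGroup.mk'_surjective N)
  have : Finite (MulAut (Subgroup.zpowers (π g))) := by
    have : Finite (ZMod (Nat.card (Subgroup.zpowers (π g))))ˣ := by
      cases Nat.card (Subgroup.zpowers (π g)) with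
      | zero => exact inferInstanceAs (Finite ℤˣ)
      | succ n => infer_instance
    exact .of_equiv _ (IsCyclic.mulAutMulEquiv _).symm.toEquiv
  let f : G →* MulAut (Subgroup.zpowers (π g)) := MulAut.conjNormal.comp π
  refine ⟨f.ker, inferInstance, inferInstance, fun x hx => ?_⟩
  have hx := congrArg Subtype.val (DFunLike.congr_fun (MonoidHom.mem_ker.1 hx)
    ⟨π g, Subgroup.mem_zpowers _⟩)
  have hx : π x * π g * (π x)⁻¹ = π g := by
    simpa [f, MulAut.conjNormal_apply] using hx
  refine (QuotientGroup.eq_one_iff (N := N) _).1 (?_ : π _ = 1)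
  simp only [map_mul, map_inv]
  rw [mul_inv_eq_one, mul_inv_eq_iff_eq_mul]
  exact (mul_inv_eq_iff_eq_mul.1 hx).symm

end Supersolvable

section Induced

namespace IndChar

variable {G : Type*} [Group G] (H : Subgroup G) (χ : H →* ℂˣ)

/-- The representation of `G` on `Ind_H^G χ`. -/
noncomputable def rho : Representation ℂ G (IndChar H χ) :=
  (Algebra.lsmul ℂ ℂ (IndChar H χ) :
    MonoidAlgebra ℂ G →ₐ[ℂ] Module.End ℂ (IndChar H χ)).toMonoidHom.comp (MonoidAlgebra.of ℂ G)

/-- The canonical generator `1 ⊗ 1` of `Ind_H^G χ`. -/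
noncomputable def gen : IndChar H χ := Submodule.Quotient.mk 1

variable {H χ}

theorem rho_apply (g : G) (v : IndChar H χ) :
    rho H χ g v = MonoidAlgebra.single g (1 : ℂ) • v := rfl

theorem rho_apply_gen (g : G) :
    rho H χ g (gen H χ) = Submodule.Quotient.mk (MonoidAlgebra.single g (1 : ℂ)) := by
  rw [rho_apply, gen, ← Submodule.Quotient.mk_smul, smul_eq_mul, mul_one]

theorem rho_apply_gen_of_mem (h : H) : rho H χ h (gen H χ) = (χ h : ℂ) • gen H χ := by
  rw [rho_apply_gen, gen, ← Submodule.Quotient.mk_smul, Submodule.Quotient.eq]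
  exact Submodule.subset_span ⟨h, rfl⟩

variable (H χ) in
theorem orbitSpan_top : orbitSpan (rho H χ) ⊤ (gen H χ) = ⊤ := by
  rw [eq_top_iff]
  rintro v -
  obtain ⟨a, rfl⟩ := Submodule.Quotient.mk_surjective _ v
  induction a using MonoidAlgebra.induction_linear with
  | zero => exact zero_mem _
  | add a b ha hb => exact add_mem ha hb
  | single g c =>
    have : (MonoidAlgebra.single g c : MonoidAlgebra ℂ G) = c • MonoidAlgebra.single g 1 := by
      simp
    rw [this, Submodule.Quotient.mk_smul, ← rho_apply_gen]
    exact Submodule.smul_mem _ _ (apply_mem_orbitSpan (Subgroup.mem_top g))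

theorem hom_ext {E : Type*} [AddCommGroup E] [Module ℂ E] {φ ψ : IndChar H χ →ₗ[ℂ] E}
    (h : ∀ g, φ (rho H χ g (gen H χ)) = ψ (rho H χ g (gen H χ))) : φ = ψ :=
  LinearMap.ext_on (orbitSpan_top H χ) (by rintro _ ⟨g, rfl⟩; exact h g)

/-- The universal property of `Ind_H^G χ` as a vector space. -/
theorem exists_lift {E : Type*} [AddCommGroup E] [Module ℂ E] (f : G → E)
    (hf : ∀ g (h : H), f (g * h) = (χ h : ℂ) • f g) :
    ∃ φ : IndChar H χ →ₗ[ℂ] E, ∀ g, φ (rho H χ g (gen H χ)) = f g := by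
  let F : MonoidAlgebra ℂ G →ₗ[ℂ] E :=
    Finsupp.linearCombination ℂ f ∘ₗ (MonoidAlgebra.coeffLinearEquiv ℂ).toLinearMap
  have hF (g : G) (c : ℂ) : F (MonoidAlgebra.single g c) = c • f g := by
    simp [F]
  set S := Submodule.span (MonoidAlgebra ℂ G)
    {x : MonoidAlgebra ℂ G | ∃ h : H,
      x = MonoidAlgebra.single (h : G) (1 : ℂ) - (χ h : ℂ) • (1 : MonoidAlgebra ℂ G)}
  have hker (x) (hx : x ∈ S) : ∀ a, F (a * x) = 0 := by
    induction hx using Submodule.span_induction with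
    | mem x hx =>
      obtain ⟨h, rfl⟩ := hx
      intro a
      induction a using MonoidAlgebra.induction_linear with
      | zero => simp
      | add a b ha hb => rw [add_mul, map_add, ha, hb, add_zero]
      | single g c =>
        rw [mul_sub, map_sub, MonoidAlgebra.single_mul_single, mul_one,
          mul_smul_comm, mul_one, map_smul, hF, hF, hf, smul_comm, sub_self]
    | zero => simp
    | add x y _ _ hx hy => intro a; rw [mul_add, map_add, hx, hy, add_zero]
    | smul b x _ hx => intro a; rw [smul_eq_mul, ← mul_assoc, hx]
  refine ⟨(S.restrictScalars ℂ).liftQ F (fun x hx => by simpa using hker x hx 1) ∘ₗ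
    (Submodule.Quotient.restrictScalarsEquiv ℂ S).symm.toLinearMap, fun g => ?_⟩
  rw [rho_apply_gen]
  exact (hF g 1).trans (one_smul _ _)

open Classical in
theorem exists_coeff : ∃ c : IndChar H χ →ₗ[ℂ] ℂ, ∀ g, c (rho H χ g (gen H χ)) =
    if hg : g ∈ H then (χ ⟨g, hg⟩ : ℂ) else 0 := by
  refine exists_lift _ fun g h => ?_
  by_cases hg : g ∈ H
  · rw [dif_pos hg, dif_pos (H.mul_mem hg h.2), smul_eq_mul, mul_comm, ← Units.val_mul, ← map_mul]
    rfl
  · rw [dif_neg hg, dif_neg (by rwa [Subgroup.mul_mem_cancel_right _ h.2]), smul_zero]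

variable (H χ) in
/-- The linear functional on `Ind_H^G χ` reading off the coefficient of `1 ⊗ 1`. -/
noncomputable def coeff : IndChar H χ →ₗ[ℂ] ℂ := exists_coeff.choose

theorem coeff_rho_of_mem (h : H) : coeff H χ (rho H χ h (gen H χ)) = χ h := by
  rw [coeff, exists_coeff.choose_spec, dif_pos h.2]

theorem coeff_rho_of_notMem {g : G} (hg : g ∉ H) : coeff H χ (rho H χ g (gen H χ)) = 0 := by
  rw [coeff, exists_coeff.choose_spec, dif_neg hg]

theorem coeff_gen : coeff H χ (gen H χ) = 1 := by
  simpa using coeff_rho_of_mem (χ := χ) 1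

theorem gen_ne_zero : gen H χ ≠ 0 := fun h => by
  simpa [h] using coeff_gen (χ := χ)

theorem rho_mul_apply (g g' : G) (v : IndChar H χ) :
    rho H χ (g * g') v = rho H χ g (rho H χ g' v) := by
  rw [map_mul, Module.End.mul_apply]

theorem eq_zero_of_coeff_rho_eq_zero {v : IndChar H χ} (hv : ∀ g, coeff H χ (rho H χ g v) = 0) :
    v = 0 := by
  let B := Finsupp.linearCombination ℂ fun t : G ⧸ H => rho H χ t.out (gen H χ)
  have hB : LinearMap.range B = ⊤ := by
    rw [eq_top_iff, ← orbitSpan_top]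
    refine Submodule.span_le.2 ?_
    rintro _ ⟨g, rfl⟩
    obtain ⟨h, hh⟩ := QuotientGroup.mk_out_eq_mul H g
    refine ⟨Finsupp.single (g : G ⧸ H) ((χ h)⁻¹ : ℂˣ), ?_⟩
    simp only [B, Finsupp.linearCombination_single]
    rw [hh, rho_mul_apply, rho_apply_gen_of_mem, map_smul, smul_smul]
    simp
  obtain ⟨f, rfl⟩ := LinearMap.range_eq_top.1 hB v
  suffices f = 0 by rw [this, map_zero]
  ext t
  have key : coeff H χ ∘ₗ rho H χ (t.out)⁻¹ ∘ₗ B = Finsupp.lapply t := by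
    refine Finsupp.lhom_ext fun s a => ?_
    simp only [B, LinearMap.comp_apply, Finsupp.linearCombination_single, map_smul,
      ← rho_mul_apply, Finsupp.lapply_apply]
    by_cases hst : s = t
    · subst hst
      rw [inv_mul_cancel]
      simp [coeff_gen]
    · rw [coeff_rho_of_notMem, smul_zero, Finsupp.single_eq_of_ne (Ne.symm hst)]
      rwa [← QuotientGroup.eq, QuotientGroup.out_eq', QuotientGroup.out_eq', eq_comm]
  have := LinearMap.congr_fun key f
  rw [Finsupp.lapply_apply] at this
  rw [← this]
  exact hv _

theorem exists_coeff_rho_ne_zero {P : Subgroup G} (hHP : H ≤ P) {w : IndChar H χ}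
    (hw : w ∈ orbitSpan (rho H χ) P (gen H χ)) (hw0 : w ≠ 0) :
    ∃ g ∈ P, coeff H χ (rho H χ g w) ≠ 0 := by
  contrapose! hw0
  refine eq_zero_of_coeff_rho_eq_zero fun g => ?_
  by_cases hg : g ∈ P
  · exact hw0 g hg
  · have : orbitSpan (rho H χ) P (gen H χ) ≤ LinearMap.ker (coeff H χ ∘ₗ rho H χ g) := by
      refine Submodule.span_le.2 ?_
      rintro _ ⟨q, rfl⟩
      rw [SetLike.mem_coe, LinearMap.mem_ker, LinearMap.comp_apply, ← rho_mul_apply]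
      exact coeff_rho_of_notMem fun h =>
        hg ((Subgroup.mul_mem_cancel_right _ q.2).1 (hHP h))
    exact this hw

/-- The projection of `Ind_H^G χ` onto the span of the `Q`-orbit of `1 ⊗ 1`. -/
theorem exists_proj {Q : Subgroup G} (hHQ : H ≤ Q) : ∃ p : IndChar H χ →ₗ[ℂ] IndChar H χ,
    (∀ q ∈ Q, ∀ v, p (rho H χ q v) = rho H χ q (p v)) ∧
    (∀ v, p v ∈ orbitSpan (rho H χ) Q (gen H χ)) ∧ ∀ v, coeff H χ (p v) = coeff H χ v := by
  classical
  obtain ⟨p, hp⟩ := exists_lift (χ := χ)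
    (fun g => if g ∈ Q then rho H χ g (gen H χ) else 0) fun g h => by
      simp only [Subgroup.mul_mem_cancel_right Q (hHQ h.2)]
      rw [rho_mul_apply, rho_apply_gen_of_mem, map_smul, smul_ite, smul_zero]
  refine ⟨p, fun q hq v => ?_, fun v => ?_, fun v => ?_⟩
  · refine LinearMap.congr_fun (f := p ∘ₗ rho H χ q) (g := rho H χ q ∘ₗ p)
      (hom_ext fun g => ?_) v
    simp only [LinearMap.comp_apply, ← rho_mul_apply, hp, Subgroup.mul_mem_cancel_left Q hq]
    split_ifs <;> simp
  · have : orbitSpan (rho H χ) ⊤ (gen H χ) ≤ (orbitSpan (rho H χ) Q (gen H χ)).comap p := by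
      refine Submodule.span_le.2 ?_
      rintro _ ⟨g, rfl⟩
      change p _ ∈ orbitSpan (rho H χ) Q (gen H χ)
      rw [hp]
      split_ifs with hg
      · exact apply_mem_orbitSpan hg
      · exact zero_mem _
    exact this (orbitSpan_top H χ ▸ Submodule.mem_top)
  · refine LinearMap.congr_fun (f := coeff H χ ∘ₗ p) (g := coeff H χ) (hom_ext fun g => ?_) v
    rw [LinearMap.comp_apply, hp]
    split_ifs with hg
    · rfl
    · rw [map_zero, coeff_rho_of_notMem fun h => hg (hHQ h)]

/-- If `χ^g ≠ χ` on `H^g ∩ H` for all `g ∉ H`, then `1 ⊗ 1` is, up to scalars, the only vector of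
`Ind_H^G χ` on which `H` acts by `χ`. -/
theorem eq_smul_gen_of_eigenvector
    (hχ : ∀ g : G, g ∉ H →
      ∃ (x : G) (hx : x ∈ H) (hgx : g * x * g⁻¹ ∈ H),
        χ ⟨g * x * g⁻¹, hgx⟩ ≠ χ ⟨x, hx⟩)
    {v : IndChar H χ} (hv : ∀ h : H, rho H χ h v = (χ h : ℂ) • v) :
    v = coeff H χ v • gen H χ := by
  have hcoeff (h : H) (w : IndChar H χ) : coeff H χ (rho H χ h w) = χ h * coeff H χ w := by
    refine LinearMap.congr_fun (f := coeff H χ ∘ₗ rho H χ h) (g := (χ h : ℂ) • coeff H χ)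
      (hom_ext fun g => ?_) w
    rw [LinearMap.comp_apply, ← rho_mul_apply, LinearMap.smul_apply]
    by_cases hg : g ∈ H
    · lift g to H using hg
      rw [← Subgroup.coe_mul, coeff_rho_of_mem, coeff_rho_of_mem]
      simp
    · rw [coeff_rho_of_notMem hg, coeff_rho_of_notMem
        (by rwa [Subgroup.mul_mem_cancel_left _ h.2]), smul_zero]
  rw [← sub_eq_zero]
  refine eq_zero_of_coeff_rho_eq_zero fun g => ?_
  by_cases hg : g ∈ H
  · lift g to H using hg
    rw [hcoeff, map_sub, map_smul, coeff_gen]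
    simp
  · rw [map_sub, map_sub, map_smul, map_smul, coeff_rho_of_notMem hg, smul_zero, sub_zero]
    obtain ⟨x, hx, hgx, hne⟩ := hχ g hg
    by_contra hc
    refine hne (Units.ext (mul_right_cancel₀ hc ?_))
    rw [← hcoeff, ← rho_mul_apply, inv_mul_cancel_right, rho_mul_apply, hv ⟨x, hx⟩, map_smul,
      map_smul, smul_eq_mul]

end IndChar

end Induced

/-- For a supersolvable group `G`, if `χ^g ≠ χ` on `H^g ∩ H` for every `g ∉ H`, then
`Ind_H^G χ` is a simple `ℂ[G]`-module. -/
theorem isSimpleModule_indChar_of_conj_ne (G : Type*) [Group G]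
    (hG : IsSupersolvable G) (H : Subgroup G) (χ : H →* ℂˣ)
    (hχ : ∀ g : G, g ∉ H →
      ∃ (x : G) (hx : x ∈ H) (hgx : g * x * g⁻¹ ∈ H),
        χ ⟨g * x * g⁻¹, hgx⟩ ≠ χ ⟨x, hx⟩) :
    IsSimpleModule (MonoidAlgebra ℂ G) (IndChar H χ) := by
  obtain ⟨k, N, hN0, hNk, hNle, hNn, hNc⟩ := hG
  have hsimple (j : ℕ) : ∀ i, i + j = k + 1 →
      IsSimpleOrbit (IndChar.rho H χ) (H ⊔ N i) (IndChar.gen H χ) := by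
    induction j with
    | zero =>
      rintro i rfl
      rw [hNk, sup_bot_eq]
      exact isSimpleOrbit_of_eigenvector IndChar.rho_apply_gen_of_mem
    | succ j ih =>
      intro i hi
      obtain ⟨g, hg⟩ := hNc i (by lia)
      have := hNn i
      have := hNn (i + 1)
      obtain ⟨C, hC, hCf, hgC⟩ := exists_finiteIndex_commutator_mem hg
      have hHQ : H ≤ H ⊔ N (i + 1) := le_sup_left
      have hQP : H ⊔ N (i + 1) ≤ H ⊔ N i := sup_le_sup_left (hNle i) H
      obtain ⟨p, hpQ, hpmem, hpc⟩ := IndChar.exists_proj (χ := χ) hHQ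
      refine (ih (i + 1) (by lia)).of_normalizer (C := C) IndChar.gen_ne_zero hHQ hQP ?_
        IndChar.rho_apply_gen_of_mem
        (fun v hv => ⟨_, IndChar.eq_smul_gen_of_eigenvector hχ hv⟩) p hpQ hpmem ?_
      · set Q := H ⊔ N (i + 1)
        have hCconj (q x : G) : x ∈ C ↔ q * x * q⁻¹ ∈ C := Subgroup.mem_normalizer_iff.1
          (Subgroup.normalizer_eq_top C ▸ Subgroup.mem_top q) x
        have hQn : Q ≤ Subgroup.normalizer ((Q ⊓ C : Subgroup G) : Set G) := by
          intro q hq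
          rw [Subgroup.mem_normalizer_iff]
          intro x
          rw [Subgroup.mem_inf, Subgroup.mem_inf, ← hCconj,
            Subgroup.mul_mem_cancel_right _ (inv_mem hq), Subgroup.mul_mem_cancel_left _ hq]
        rw [hg, ← sup_assoc]
        refine sup_le hQn ((Subgroup.closure_le _).2 (Set.singleton_subset_iff.2 ?_))
        rw [SetLike.mem_coe, Subgroup.mem_normalizer_iff]
        intro x
        rw [Subgroup.mem_inf, Subgroup.mem_inf, ← hCconj]
        refine and_congr_left fun hx => ?_
        have hcomm : g * x * g⁻¹ * x⁻¹ ∈ Q := (le_sup_right : N (i + 1) ≤ Q) (hgC x hx)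
        rw [← Subgroup.mul_mem_cancel_left Q hcomm, inv_mul_cancel_right]
      · intro w hw hw0
        obtain ⟨g, hg, hgw⟩ := IndChar.exists_coeff_rho_ne_zero le_sup_left hw hw0
        exact ⟨g, hg, fun h => hgw (by rw [← hpc, h, map_zero])⟩
  have htop := hsimple (k + 1) 0 (zero_add _)
  rw [hN0, sup_top_eq] at htop
  have : Nontrivial (IndChar H χ) := ⟨_, _, IndChar.gen_ne_zero⟩
  rw [isSimpleModule_iff]
  refine { eq_bot_or_eq_top := fun W => or_iff_not_imp_left.2 fun hW => ?_ }
  have hst : IsStableUnder (IndChar.rho H χ) ⊤ (W.restrictScalars ℂ) :=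
    fun g _ w hw => W.smul_mem (MonoidAlgebra.single g 1) hw
  have hgen := htop (W.restrictScalars ℂ) (by rw [IndChar.orbitSpan_top]; exact le_top) hst
    (by rwa [Ne, Submodule.restrictScalars_eq_bot_iff])
  have hle := orbitSpan_le hst hgen
  rw [IndChar.orbitSpan_top, top_le_iff] at hle
  exact Submodule.restrictScalars_eq_top_iff _ _ _ |>.1 hle
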